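/- Let H = 1/6, let (Ω,F,P) be a probability space, and let X¹, X² : ℝ → Ω → ℝ be two independent centered Gaussian processes, each with covariance C_{1/6}. Let f₁, f₂, f₃, f₄ ∈ C_b^∞(ℝ²) and fix t ≥ 0. Then there exists a constant C > 0, depending only on f₁,…,f₄ (not on n or t), such that sup_{n≥1} sup_{i₁,i₂ ∈ {0,…,⌊2^{n/2}t⌋−1}} Σ_{i₃,i₄=0}^{⌊2^{n/2}t⌋−1} | E[ Π_{a=1}^{4} Δ_{i_a,n}f_a(X¹,X²) · Δ¹_{i₃,n}·((Δ²_{i₃,n})² − 2^{−n/3}) · Δ¹_{i₄,n}·((Δ²_{i₄,n})² − 2^{−n/3}) ] | ≤ C(t + t²). -/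

import Mathlib

open MeasureTheory ProbabilityTheory Filter

noncomputable section

/-- Covariance function of the (two-sided) fractional Brownian motion with Hurst index `H`:
`C_H(t,s) = (|t|^{2H} + |s|^{2H} − |t−s|^{2H})/2`. -/
def covH (H t s : ℝ) : ℝ :=
  (|t| ^ (2 * H) + |s| ^ (2 * H) - |t - s| ^ (2 * H)) / 2

/-- `ρ_H(k) = (1/2)(|k+1|^{2H} + |k−1|^{2H} − 2|k|^{2H})`. -/
def rhoH (H : ℝ) (k : ℤ) : ℝ :=
  (|(k : ℝ) + 1| ^ (2 * H) + |(k : ℝ) - 1| ^ (2 * H) - 2 * |(k : ℝ)| ^ (2 * H)) / 2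

/-- `X` is a centered Gaussian process with covariance function `C` under `P`: every finite
linear combination of values of the process is a centered real Gaussian random variable with
the appropriate variance. -/
def IsCenteredGaussianProcess {Ω : Type*} [MeasurableSpace Ω] (P : Measure Ω)
    (X : ℝ → Ω → ℝ) (C : ℝ → ℝ → ℝ) : Prop :=
  (∀ t, Measurable (X t)) ∧
  ∀ (m : ℕ) (ts : Fin m → ℝ) (c : Fin m → ℝ),
    Measure.map (fun ω => ∑ i, c i * X (ts i) ω) P =
      gaussianReal 0 (Real.toNNReal (∑ i, ∑ j, c i * c j * C (ts i) (ts j)))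

/-- The σ-algebras generated by the two processes `X1` and `X2` are independent under `P`. -/
def IndepProcesses {Ω : Type*} [MeasurableSpace Ω] (P : Measure Ω)
    (X1 X2 : ℝ → Ω → ℝ) : Prop :=
  ProbabilityTheory.Indep
    (⨆ t : ℝ, MeasurableSpace.comap (X1 t) inferInstance)
    (⨆ t : ℝ, MeasurableSpace.comap (X2 t) inferInstance) P

/-- `g` is infinitely differentiable and bounded together with all its derivatives. -/
def CbSmooth {E : Type*} [NormedAddCommGroup E] [NormedSpace ℝ E] (g : E → ℝ) : Prop :=
  (∀ n : ℕ, ContDiff ℝ n g) ∧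
  ∀ k : ℕ, ∃ M : ℝ, ∀ x : E, ‖iteratedFDeriv ℝ k g x‖ ≤ M

/-- `f : ℝ² → ℝ` (in curried form) belongs to `C_b^∞(ℝ²)`. -/
def CbSmooth2 (f : ℝ → ℝ → ℝ) : Prop :=
  CbSmooth fun p : ℝ × ℝ => f p.1 p.2

/-- Partial derivative of `f : ℝ → ℝ → ℝ`, taken `k` times in the first variable and `l` times
in the second variable. -/
def pd (k l : ℕ) (f : ℝ → ℝ → ℝ) (x y : ℝ) : ℝ :=
  iteratedDeriv k (fun u => iteratedDeriv l (fun v => f u v) y) x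

/-- The dyadic point `j·2^{−n/2}`. -/
def dyadicPt (n j : ℕ) : ℝ := (j : ℝ) * (2 : ℝ) ^ (-(n : ℝ) / 2)

/-- The number of dyadic steps `⌊2^{n/2} t⌋`. -/
def nSteps (n : ℕ) (t : ℝ) : ℕ := Nat.floor ((2 : ℝ) ^ ((n : ℝ) / 2) * t)

variable {Ω : Type*}

/-- The increment `X_{(j+1)2^{−n/2}} − X_{j2^{−n/2}}` of the process `X`. -/
def Xincr (X : ℝ → Ω → ℝ) (n j : ℕ) (ω : Ω) : ℝ :=
  X (dyadicPt n (j + 1)) ω - X (dyadicPt n j) ω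

/-- The midpoint evaluation `Δ_{j,n} g(X¹,X²)`. -/
def Xmid (X1 X2 : ℝ → Ω → ℝ) (g : ℝ → ℝ → ℝ) (n j : ℕ) (ω : Ω) : ℝ :=
  g ((X1 (dyadicPt n (j + 1)) ω + X1 (dyadicPt n j) ω) / 2)
    ((X2 (dyadicPt n (j + 1)) ω + X2 (dyadicPt n j) ω) / 2)

/-- Stein's identity for a centered real Gaussian measure. -/
theorem integral_mul_gaussianReal_eq {v : NNReal} {g g' : ℝ → ℝ}
    (hg : ∀ x, HasDerivAt g (g' x) x)
    (h0 : Integrable g (gaussianReal 0 v))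
    (h1 : Integrable (fun x => x * g x) (gaussianReal 0 v))
    (h2 : Integrable g' (gaussianReal 0 v)) :
    ∫ x, x * g x ∂gaussianReal 0 v = v * ∫ x, g' x ∂gaussianReal 0 v := by
  rcases eq_or_ne v 0 with rfl | hv
  · simp
  have hvR : (v : ℝ) ≠ 0 := by exact_mod_cast hv
  have key : ∀ f : ℝ → ℝ, Integrable f (gaussianReal 0 v) →
      Integrable (fun x => gaussianPDFReal 0 v x * f x) := by
    intro f hf
    rw [gaussianReal_of_var_ne_zero _ hv,
      integrable_withDensity_iff_integrable_smul' (measurable_gaussianPDF _ _)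
        (ae_of_all _ fun _ => gaussianPDF_lt_top)] at hf
    simpa [toReal_gaussianPDF] using hf
  have hp : ∀ x, HasDerivAt (gaussianPDFReal 0 v) (gaussianPDFReal 0 v x * (-x / v)) x := by
    intro x
    have h : HasDerivAt (fun y : ℝ => -(y - 0) ^ 2 / (2 * (v : ℝ))) (-x / v) x := by
      have := (((hasDerivAt_id x).sub_const 0).pow 2).neg.div_const (2 * (v : ℝ))
      refine this.congr_deriv ?_
      simp
      field_simp
    rw [gaussianPDFReal_def]
    refine (h.exp.const_mul _).congr_deriv ?_
    ring
  have hz := integral_eq_zero_of_hasDerivAt_of_integrable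
    (f := fun x => gaussianPDFReal 0 v x * g x)
    (f' := fun x => gaussianPDFReal 0 v x * g' x -
      (v : ℝ)⁻¹ * (gaussianPDFReal 0 v x * (x * g x)))
    (fun x => ((hp x).mul (hg x)).congr_deriv (by field_simp; ring))
    ((key _ h2).sub ((key _ h1).const_mul _)) (key _ h0)
  rw [integral_sub (key _ h2) ((key _ h1).const_mul _), integral_const_mul] at hz
  rw [integral_gaussianReal_eq_integral_smul hv, integral_gaussianReal_eq_integral_smul hv]
  simp only [smul_eq_mul]
  rw [sub_eq_zero.1 hz, mul_inv_cancel_left₀ hvR]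

/-- Gaussian integration by parts: if `(D, V)` is a Gaussian vector with `D` centered, and `F'` is
the derivative of `F` along the vector of the covariances of `D` with `V`, then
`E[D F(V)] = E[F'(V)]`. -/
theorem ProbabilityTheory.HasGaussianLaw.integral_mul_comp_eq {Ω ι : Type*} [MeasurableSpace Ω]
    [Fintype ι] {P : Measure Ω} {D : Ω → ℝ} {V : ι → Ω → ℝ}
    (hDV : HasGaussianLaw (fun ω => (D ω, fun i => V i ω)) P) (hD : ∫ ω, D ω ∂P = 0)
    {F F' : (ι → ℝ) → ℝ} (hFm : Measurable F) (hFm' : Measurable F')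
    (hF : ∀ x, HasDerivAt (fun s : ℝ => F (x + s • fun i => cov[D, V i; P])) (F' x) 0)
    (h0 : Integrable (fun ω => F fun i => V i ω) P)
    (h1 : Integrable (fun ω => D ω * F fun i => V i ω) P)
    (h2 : Integrable (fun ω => F' fun i => V i ω) P) :
    ∫ ω, D ω * F (fun i => V i ω) ∂P = ∫ ω, F' (fun i => V i ω) ∂P := by
  have hP := hDV.isProbabilityMeasure
  have hDG : HasGaussianLaw D P := hDV.fst
  have hVG : HasGaussianLaw (fun ω i => V i ω) P := hDV.snd
  have hVi : ∀ i, HasGaussianLaw (V i) P := fun i => hVG.eval i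
  set c : ι → ℝ := fun i => cov[D, V i; P] with hc
  have hlaw := hDG.map_eq_gaussianReal
  rw [hD] at hlaw
  set v : NNReal := Var[D; P].toNNReal with hv
  have hvar : Var[D; P] = v := by rw [hv, Real.coe_toNNReal _ (variance_nonneg _ _)]
  rcases eq_or_ne v 0 with h | hv0
  · have hD0 : D =ᵐ[P] 0 := by
      rw [h, gaussianReal_zero_var] at hlaw
      have : ∀ᵐ x ∂(P.map D), x = 0 := by rw [hlaw]; simp
      exact ae_of_ae_map hDG.aemeasurable this
    have hc0 : c = 0 := by
      funext i
      have : cov[D, V i; P] = cov[(0 : Ω → ℝ), V i; P] := by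
        unfold covariance
        rw [hD]
        refine integral_congr_ae ?_
        filter_upwards [hD0] with ω hω
        simp [hω]
      simpa [hc] using this
    have hF0 : ∀ x, F' x = 0 := fun x => by
      have := hF x
      simp only [hc0, smul_zero, add_zero] at this
      exact this.unique (hasDerivAt_const _ _)
    simp only [hF0, integral_zero]
    refine integral_eq_zero_of_ae ?_
    filter_upwards [hD0] with ω hω
    simp [hω]
  have hv' : (v : ℝ) ≠ 0 := by exact_mod_cast hv0
  set β : ι → ℝ := fun i => c i / v with hβ
  set W : ι → Ω → ℝ := fun i ω => V i ω - β i * D ω with hW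
  have hDm : AEMeasurable D P := hDG.aemeasurable
  have hindep : IndepFun (fun ω i => W i ω) D P := by
    have hG : HasGaussianLaw (fun ω => ((fun _ : Unit => D ω), fun i => W i ω)) P :=
      hDV.map_fun (F := (Unit → ℝ) × (ι → ℝ))
        ((ContinuousLinearMap.pi fun _ => ContinuousLinearMap.fst ℝ ℝ (ι → ℝ)).prod
          (ContinuousLinearMap.pi fun i =>
            (ContinuousLinearMap.proj i).comp (ContinuousLinearMap.snd ℝ ℝ (ι → ℝ)) -
              β i • ContinuousLinearMap.fst ℝ ℝ (ι → ℝ)))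
    have hI := hG.indepFun_of_covariance_eval (X := fun _ => D) (Y := W) fun _ i => by
      have : W i = V i - (fun ω => β i * D ω) := rfl
      rw [this, covariance_sub_right hDG.memLp_two (hVi i).memLp_two
        (hDG.memLp_two.const_mul _), covariance_const_mul_right, covariance_self hDm, hvar]
      simp only [hβ]
      field_simp
      simp [hc]
    exact (hI.comp (φ := fun x : Unit → ℝ => x ()) (ψ := id) (measurable_pi_apply _)
      measurable_id).symm
  have hWm : AEMeasurable (fun ω i => W i ω) P :=
    aemeasurable_pi_lambda _ fun i => (hVi i).aemeasurable.sub (hDm.const_mul _)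
  have hjoint := (indepFun_iff_map_prod_eq_prod_map_map hWm hDm).1 hindep
  rw [hlaw] at hjoint
  have hWD : AEMeasurable (fun ω => ((fun i => W i ω), D ω)) P := hWm.prodMk hDm
  have hVW : ∀ ω, (fun i => V i ω) = (fun i => W i ω) + D ω • β := by
    intro ω; funext i; simp [hW]; ring
  have hsh : Measurable fun p : (ι → ℝ) × ℝ => p.1 + p.2 • β := by fun_prop
  have hν : IsProbabilityMeasure (P.map fun ω i => W i ω) := Measure.isProbabilityMeasure_map hWm
  have tr : ∀ G : (ι → ℝ) × ℝ → ℝ, Measurable G →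
      Integrable (fun ω => G ((fun i => W i ω), D ω)) P →
      Integrable G ((P.map fun ω i => W i ω).prod (gaussianReal 0 v)) ∧
      ∫ ω, G ((fun i => W i ω), D ω) ∂P =
        ∫ w, ∫ x, G (w, x) ∂gaussianReal 0 v ∂(P.map fun ω i => W i ω) := by
    intro G hG hi
    have hI : Integrable G ((P.map fun ω i => W i ω).prod (gaussianReal 0 v)) := by
      rw [← hjoint]
      exact (integrable_map_measure hG.aestronglyMeasurable hWD).2 hi
    refine ⟨hI, ?_⟩
    rw [← integral_prod _ hI, ← hjoint, integral_map hWD hG.aestronglyMeasurable]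
  simp only [hVW] at h0 h1 h2 ⊢
  obtain ⟨i0, -⟩ := tr (fun p => F (p.1 + p.2 • β)) (hFm.comp hsh) h0
  obtain ⟨i1, e1⟩ := tr (fun p => p.2 * F (p.1 + p.2 • β))
    (measurable_snd.mul (hFm.comp hsh)) h1
  obtain ⟨i2, e2⟩ := tr (fun p => F' (p.1 + p.2 • β)) (hFm'.comp hsh) h2
  refine e1.trans (Eq.trans ?_ e2.symm)
  refine integral_congr_ae ?_
  filter_upwards [i0.prod_right_ae, i1.prod_right_ae, i2.prod_right_ae] with w j0 j1 j2
  have hd : ∀ x, HasDerivAt (fun x : ℝ => F (w + x • β)) ((v : ℝ)⁻¹ * F' (w + x • β)) x := by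
    intro x
    have h := hF (w + x • β)
    have hin : HasDerivAt (fun y : ℝ => (y - x) / v) ((v : ℝ)⁻¹) x := by
      simpa using ((hasDerivAt_id x).sub_const x).div_const (v : ℝ)
    have h' : HasDerivAt (fun s : ℝ => F ((w + x • β) + s • c)) (F' (w + x • β)) ((x - x) / v) := by
      simpa using h
    have := HasDerivAt.comp x h' hin
    refine (this.congr_deriv (mul_comm _ _)).congr_of_eventuallyEq (Eventually.of_forall ?_)
    intro y
    simp only [Function.comp]
    congr 1
    funext i
    simp [hβ]
    field_simp
    ring
  rw [integral_mul_gaussianReal_eq hd j0 j1 (j2.const_mul _), integral_const_mul]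
  field_simp

theorem abs_prod_le_pow_card {ι : Type*} [Fintype ι] {M : ℝ} {u : ι → ℝ} (hu : ∀ i, |u i| ≤ M) :
    |∏ i, u i| ≤ M ^ Fintype.card ι := by
  rw [Finset.abs_prod, ← Finset.card_univ, ← Finset.prod_const]
  exact Finset.prod_le_prod (fun _ _ => abs_nonneg _) fun i _ => hu i

theorem measurable_of_hasDerivAt {h h' : ℝ → ℝ} (hh : ∀ x, HasDerivAt h (h' x) x) :
    Measurable h ∧ Measurable h' := by
  refine ⟨(continuous_iff_continuousAt.2 fun x => (hh x).continuousAt).measurable, ?_⟩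
  rw [show h' = deriv h from funext fun x => (hh x).deriv.symm]
  exact measurable_deriv h

/-- The derivative of `x ↦ ∏ a, h a (x a)` along `c`, with the product rule written through
`Function.update`. -/
theorem hasDerivAt_prod_comp_line {ι : Type*} [Fintype ι] [DecidableEq ι] {h h' : ι → ℝ → ℝ}
    (hh : ∀ a x, HasDerivAt (h a) (h' a x) x) (c x : ι → ℝ) :
    HasDerivAt (fun s : ℝ => ∏ a, h a ((x + s • c) a))
      (∑ a, c a * ∏ b, Function.update h a (h' a) b (x b)) 0 := by
  have h1 : ∀ a ∈ (Finset.univ : Finset ι),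
      HasDerivAt (fun s : ℝ => h a ((x + s • c) a)) (h' a (x a) * c a) 0 := by
    intro a _
    have hin : HasDerivAt (fun s : ℝ => (x + s • c) a) (c a) 0 := by
      simpa using ((hasDerivAt_id (0 : ℝ)).mul_const (c a)).const_add (x a)
    have h2 : HasDerivAt (h a) (h' a (x a)) ((x + (0 : ℝ) • c) a) := by simpa using hh a (x a)
    exact h2.comp 0 hin
  refine (HasDerivAt.fun_finsetProd h1).congr_deriv (Finset.sum_congr rfl fun a _ => ?_)
  rw [← Finset.mul_prod_erase _ _ (Finset.mem_univ a), Function.update_self, smul_eq_mul]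
  have : ∏ b ∈ Finset.univ.erase a, Function.update h a (h' a) b (x b) =
      ∏ b ∈ Finset.univ.erase a, h b (x b) :=
    Finset.prod_congr rfl fun b hb => by
      rw [Function.update_of_ne (Finset.ne_of_mem_erase hb)]
  rw [this]
  simp
  ring

section GaussianProducts

variable {Ω ι : Type*} [MeasurableSpace Ω] [Fintype ι] {P : Measure Ω}
  {D E : Ω → ℝ} {V : ι → Ω → ℝ} {h h' h'' : ι → ℝ → ℝ} {M : ℝ}

theorem integrable_mul_prod_comp {Z : Ω → ℝ} (hZ : Integrable Z P)
    (hV : ∀ i, AEMeasurable (V i) P) (hm : ∀ a, Measurable (h a)) (hM : ∀ a x, |h a x| ≤ M) :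
    Integrable (fun ω => Z ω * ∏ a, h a (V a ω)) P := by
  refine hZ.mul_bdd (c := M ^ Fintype.card ι) ?_
    (ae_of_all _ fun ω => abs_prod_le_pow_card fun a => hM a _)
  exact (Finset.aemeasurable_fun_prod _ fun a _ =>
    (hm a).comp_aemeasurable (hV a)).aestronglyMeasurable

theorem ProbabilityTheory.HasGaussianLaw.abs_integral_mul_prod_le
    (hDV : HasGaussianLaw (fun ω => (D ω, fun i => V i ω)) P) (hD : ∫ ω, D ω ∂P = 0)
    (hh : ∀ a x, HasDerivAt (h a) (h' a x) x)
    (hM : ∀ a x, |h a x| ≤ M) (hM' : ∀ a x, |h' a x| ≤ M) :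
    |∫ ω, D ω * ∏ a, h a (V a ω) ∂P| ≤
      M ^ Fintype.card ι * ∑ a, |cov[D, V a; P]| := by
  classical
  have hP := hDV.isProbabilityMeasure
  have hDG : HasGaussianLaw D P := hDV.fst
  have hVm : ∀ i, AEMeasurable (V i) P := fun i => (hDV.snd.eval i).aemeasurable
  have hm : ∀ a, Measurable (h a) := fun a => (measurable_of_hasDerivAt (hh a)).1
  have hum : ∀ a b, Measurable (Function.update h a (h' a) b) := by
    intro a b
    rcases eq_or_ne b a with rfl | hb
    · simpa using (measurable_of_hasDerivAt (hh b)).2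
    · simpa [Function.update_of_ne hb] using hm b
  have huM : ∀ a b x, |Function.update h a (h' a) b x| ≤ M := by
    intro a b x
    rcases eq_or_ne b a with rfl | hb
    · simpa using hM' b x
    · simpa [Function.update_of_ne hb] using hM b x
  have hi2 : Integrable (fun ω => ∑ a, cov[D, V a; P] *
      ∏ b, Function.update h a (h' a) b (V b ω)) P :=
    integrable_finsetSum _ fun a _ => integrable_mul_prod_comp (integrable_const _) hVm (hum a)
      (huM a)
  rw [hDV.integral_mul_comp_eq hD (F := fun x => ∏ a, h a (x a))
    (F' := fun x => ∑ a, cov[D, V a; P] * ∏ b, Function.update h a (h' a) b (x b))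
    (Finset.measurable_fun_prod _ fun a _ => (hm a).comp (measurable_pi_apply a))
    (Finset.measurable_fun_sum _ fun a _ => (Finset.measurable_fun_prod _ fun b _ =>
      (hum a b).comp (measurable_pi_apply b)).const_mul _)
    (fun x => hasDerivAt_prod_comp_line hh _ x)
    (by simpa using integrable_mul_prod_comp (integrable_const (1 : ℝ)) hVm hm hM)
    (integrable_mul_prod_comp hDG.integrable hVm hm hM) hi2]
  have hb : ∀ ω, ‖∑ a, cov[D, V a; P] * ∏ b, Function.update h a (h' a) b (V b ω)‖ ≤
      M ^ Fintype.card ι * ∑ a, |cov[D, V a; P]| := by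
    intro ω
    rw [Finset.mul_sum]
    refine (Finset.abs_sum_le_sum_abs _ _).trans (Finset.sum_le_sum fun a _ => ?_)
    rw [abs_mul, mul_comm]
    exact mul_le_mul_of_nonneg_right (abs_prod_le_pow_card fun b => huM a b _) (abs_nonneg _)
  simpa using norm_integral_le_of_norm_le_const (μ := P) (ae_of_all _ hb)

theorem ProbabilityTheory.HasGaussianLaw.abs_integral_mul_mul_prod_le
    (hDV : HasGaussianLaw (fun ω => (D ω, fun o : Option ι => o.elim (E ω) fun i => V i ω)) P)
    (hD : ∫ ω, D ω ∂P = 0) (hE : ∫ ω, E ω ∂P = 0)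
    (hh : ∀ a x, HasDerivAt (h a) (h' a x) x) (hh' : ∀ a x, HasDerivAt (h' a) (h'' a x) x)
    (hM : ∀ a x, |h a x| ≤ M) (hM' : ∀ a x, |h' a x| ≤ M) (hM'' : ∀ a x, |h'' a x| ≤ M) :
    |∫ ω, D ω * (E ω * ∏ a, h a (V a ω)) ∂P| ≤
      M ^ Fintype.card ι *
        (|cov[D, E; P]| + ∑ a, ∑ b, |cov[D, V a; P]| * |cov[E, V b; P]|) := by
  classical
  have hP := hDV.isProbabilityMeasure
  have hDG : HasGaussianLaw D P := hDV.fst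
  have hEV : HasGaussianLaw (fun ω => (E ω, fun i => V i ω)) P :=
    hDV.map_fun (F := ℝ × (ι → ℝ))
      (((ContinuousLinearMap.proj none).prod
        (ContinuousLinearMap.pi fun i => ContinuousLinearMap.proj (some i))).comp
          (ContinuousLinearMap.snd ℝ ℝ (Option ι → ℝ)))
  have hEG : HasGaussianLaw E P := hEV.fst
  have hDEi : Integrable (fun ω => D ω * E ω) P := hDG.memLp_two.integrable_mul hEG.memLp_two
  have hVm : ∀ i, AEMeasurable (V i) P := fun i => (hEV.snd.eval i).aemeasurable
  have hm : ∀ a, Measurable (h a) := fun a => (measurable_of_hasDerivAt (hh a)).1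
  have hum : ∀ a b, Measurable (Function.update h a (h' a) b) := by
    intro a b
    rcases eq_or_ne b a with rfl | hb
    · simpa using (measurable_of_hasDerivAt (hh b)).2
    · simpa [Function.update_of_ne hb] using hm b
  have huM : ∀ a b x, |Function.update h a (h' a) b x| ≤ M := by
    intro a b x
    rcases eq_or_ne b a with rfl | hb
    · simpa using hM' b x
    · simpa [Function.update_of_ne hb] using hM b x
  have hud : ∀ a b x, HasDerivAt (Function.update h a (h' a) b)
      (Function.update h' a (h'' a) b x) x := by
    intro a b x
    rcases eq_or_ne b a with rfl | hb
    · simpa using hh' b x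
    · simpa [Function.update_of_ne hb] using hh b x
  have huM' : ∀ a b x, |Function.update h' a (h'' a) b x| ≤ M := by
    intro a b x
    rcases eq_or_ne b a with rfl | hb
    · simpa using hM'' b x
    · simpa [Function.update_of_ne hb] using hM' b x
  have ii1 : Integrable (fun ω => cov[D, E; P] * ∏ a, h a (V a ω)) P :=
    integrable_mul_prod_comp (integrable_const _) hVm hm hM
  have ii2 : ∀ a, Integrable (fun ω => cov[D, V a; P] *
      (E ω * ∏ b, Function.update h a (h' a) b (V b ω))) P := fun a =>
    (integrable_mul_prod_comp hEG.integrable hVm (hum a) (huM a)).const_mul _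
  have key := hDV.integral_mul_comp_eq hD
    (V := fun o ω => o.elim (E ω) fun i => V i ω)
    (F := fun x => x none * ∏ a, h a (x (some a)))
    (F' := fun x => cov[D, E; P] * ∏ a, h a (x (some a)) +
      ∑ a, cov[D, V a; P] * (x none * ∏ b, Function.update h a (h' a) b (x (some b))))
    ((measurable_pi_apply _).mul
      (Finset.measurable_fun_prod _ fun a _ => (hm a).comp (measurable_pi_apply _)))
    (((Finset.measurable_fun_prod _ fun a _ =>
        (hm a).comp (measurable_pi_apply _)).const_mul _).add
      (Finset.measurable_fun_sum _ fun a _ => ((measurable_pi_apply _).mul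
        (Finset.measurable_fun_prod _ fun b _ =>
          (hum a b).comp (measurable_pi_apply _))).const_mul _))
    (fun x => by
      have hn : HasDerivAt (fun s : ℝ => x none + s * cov[D, E; P]) (cov[D, E; P]) 0 := by
        simpa using ((hasDerivAt_id (0 : ℝ)).mul_const (cov[D, E; P])).const_add (x none)
      have := hn.mul (hasDerivAt_prod_comp_line hh (fun a => cov[D, V a; P]) fun a => x (some a))
      refine this.congr_deriv ?_
      simp only [zero_smul, add_zero, zero_mul, Finset.mul_sum]
      congr 1
      exact Finset.sum_congr rfl fun a _ => by ring)
    (integrable_mul_prod_comp hEG.integrable hVm hm hM)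
    (by simpa [mul_assoc] using integrable_mul_prod_comp hDEi hVm hm hM)
    (ii1.add (integrable_finsetSum _ fun a _ => ii2 a))
  simp only [Option.elim] at key
  rw [key, integral_add ii1 (integrable_finsetSum _ fun a _ => ii2 a),
    integral_finsetSum _ fun a _ => ii2 a, mul_add]
  refine (abs_add_le _ _).trans (add_le_add ?_ ?_)
  · have hb : ∀ ω, ‖cov[D, E; P] * ∏ a, h a (V a ω)‖ ≤
        M ^ Fintype.card ι * |cov[D, E; P]| := by
      intro ω
      rw [norm_mul, mul_comm]
      exact mul_le_mul_of_nonneg_right (abs_prod_le_pow_card fun b => hM b _) (abs_nonneg _)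
    simpa using norm_integral_le_of_norm_le_const (μ := P) (ae_of_all _ hb)
  · rw [Finset.mul_sum]
    refine (Finset.abs_sum_le_sum_abs _ _).trans (Finset.sum_le_sum fun a _ => ?_)
    rw [integral_const_mul, abs_mul, ← Finset.mul_sum, mul_left_comm]
    exact mul_le_mul_of_nonneg_left
      (hEV.abs_integral_mul_prod_le hE (hud a) (huM a) (huM' a)) (abs_nonneg _)

end GaussianProducts

section PowerSums

variable {r : ℝ}

theorem abs_rpow_succ_sub_le_one (hr0 : 0 < r) (hr1 : r ≤ 1) (x : ℝ) :
    |(|x + 1| ^ r - |x| ^ r)| ≤ 1 := by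
  have key : ∀ u v : ℝ, |u| ≤ |v| + 1 → |u| ^ r ≤ |v| ^ r + 1 := fun u v huv =>
    calc |u| ^ r ≤ (|v| + 1) ^ r := Real.rpow_le_rpow (abs_nonneg _) huv hr0.le
      _ ≤ |v| ^ r + 1 ^ r := Real.rpow_add_le_add_rpow (abs_nonneg _) zero_le_one hr0.le hr1
      _ = |v| ^ r + 1 := by rw [Real.one_rpow]
  have h1 := key (x + 1) x (by simpa using abs_add_le x 1)
  have h2 := key x (x + 1) (by simpa using abs_sub (x + 1) 1)
  rw [abs_le]
  constructor <;> linarith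

theorem abs_rpow_succ_add_pred_le (hr0 : 0 < r) (hr1 : r ≤ 1) {x : ℝ} (hx : 1 ≤ |x|) :
    |x + 1| ^ r + |x - 1| ^ r ≤ 2 * |x| ^ r := by
  have key : ∀ y : ℝ, 1 ≤ y → (y + 1) ^ r + (y - 1) ^ r ≤ 2 * y ^ r := by
    intro y hy
    have := (Real.concaveOn_rpow hr0.le hr1).2
      (Set.mem_Ici.2 (by linarith : 0 ≤ y + 1)) (Set.mem_Ici.2 (by linarith : 0 ≤ y - 1))
      (by norm_num : (0 : ℝ) ≤ 1 / 2) (by norm_num : (0 : ℝ) ≤ 1 / 2) (by norm_num)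
    simp only [smul_eq_mul] at this
    rw [show 1 / 2 * (y + 1) + 1 / 2 * (y - 1) = y by ring] at this
    linarith
  rcases le_total 0 x with h | h
  · rw [abs_of_nonneg h] at hx ⊢
    rw [abs_of_nonneg (by linarith : 0 ≤ x + 1), abs_of_nonneg (by linarith : 0 ≤ x - 1)]
    exact key x hx
  · rw [abs_of_nonpos h] at hx ⊢
    rw [abs_of_nonpos (by linarith : x + 1 ≤ 0), abs_of_nonpos (by linarith : x - 1 ≤ 0)]
    have := key (-x) hx
    rw [show -(x + 1) = -x - 1 by ring, show -(x - 1) = -x + 1 by ring]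
    linarith

theorem sum_abs_rpow_sub_le (hr0 : 0 < r) {p N : ℕ} (hp : p ≤ N) :
    ∑ j ∈ Finset.range N, |(|(p : ℝ) - j| ^ r - |(p : ℝ) - (j + 1 : ℕ)| ^ r)| ≤
      2 * (N : ℝ) ^ r := by
  let s : ℝ → ℝ := fun x => if 0 ≤ x then |x| ^ r else -|x| ^ r
  have hs0 : ∀ x, 0 ≤ x → s x = |x| ^ r := fun x hx => if_pos hx
  have hs1 : ∀ x, x ≤ 0 → s x = -|x| ^ r := by
    intro x hx
    rcases hx.eq_or_lt with rfl | hx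
    · simp [s, Real.zero_rpow hr0.ne']
    · exact if_neg (not_le.2 hx)
  have hstep : ∀ j ∈ Finset.range N,
      |(|(p : ℝ) - j| ^ r - |(p : ℝ) - (j + 1 : ℕ)| ^ r)| ≤
        s ((p : ℝ) - j) - s ((p : ℝ) - (j + 1 : ℕ)) := by
    intro j _
    push_cast
    rcases lt_or_ge j p with h | h
    · have h' : (j : ℝ) + 1 ≤ p := by exact_mod_cast h
      rw [hs0 _ (by linarith), hs0 _ (by linarith), abs_of_nonneg]
      refine sub_nonneg.2 (Real.rpow_le_rpow (abs_nonneg _) ?_ hr0.le)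
      rw [abs_of_nonneg (by linarith), abs_of_nonneg (by linarith)]
      linarith
    · have h' : (p : ℝ) ≤ j := by exact_mod_cast h
      rw [hs1 _ (by linarith), hs1 _ (by linarith), abs_of_nonpos]
      · linarith
      refine sub_nonpos.2 (Real.rpow_le_rpow (abs_nonneg _) ?_ hr0.le)
      rw [abs_of_nonpos (by linarith), abs_of_nonpos (by linarith)]
      linarith
  refine (Finset.sum_le_sum hstep).trans ?_
  rw [Finset.sum_range_sub' (fun j : ℕ => s ((p : ℝ) - j))]
  have hp' : (p : ℝ) ≤ N := by exact_mod_cast hp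
  have hp0 : (0 : ℝ) ≤ p := Nat.cast_nonneg p
  rw [hs0 _ (by simp), hs1 _ (by linarith)]
  have h1 : |(p : ℝ) - (0 : ℕ)| ^ r ≤ (N : ℝ) ^ r :=
    Real.rpow_le_rpow (abs_nonneg _) (by simpa using hp') hr0.le
  have h2 : |(p : ℝ) - N| ^ r ≤ (N : ℝ) ^ r := by
    refine Real.rpow_le_rpow (abs_nonneg _) ?_ hr0.le
    rw [abs_of_nonpos (by linarith)]
    linarith
  linarith

theorem sum_rpow_succ_sub (hr0 : 0 < r) (N : ℕ) :
    ∑ j ∈ Finset.range N, |(|(j : ℝ) + 1| ^ r - |(j : ℝ)| ^ r)| = (N : ℝ) ^ r := by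
  have hstep : ∀ j ∈ Finset.range N, |(|(j : ℝ) + 1| ^ r - |(j : ℝ)| ^ r)| =
      ((j + 1 : ℕ) : ℝ) ^ r - (j : ℝ) ^ r := by
    intro j _
    have hj : (0 : ℝ) ≤ j := Nat.cast_nonneg j
    rw [abs_of_nonneg (by linarith : (0 : ℝ) ≤ j + 1), abs_of_nonneg hj, abs_of_nonneg]
    · push_cast; rfl
    · exact sub_nonneg.2 (Real.rpow_le_rpow hj (by linarith) hr0.le)
  rw [Finset.sum_congr rfl hstep, Finset.sum_range_sub fun j : ℕ => (j : ℝ) ^ r]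
  simp [Real.zero_rpow hr0.ne']

theorem sum_abs_rhoH_le {H : ℝ} (hr0 : 0 < 2 * H) (hr1 : 2 * H ≤ 1) (i N : ℕ) :
    ∑ j ∈ Finset.range N, |rhoH H ((i : ℤ) - j)| ≤ 3 := by
  let d : ℝ → ℝ := fun x => |x + 1| ^ (2 * H) - |x| ^ (2 * H)
  have hd : ∀ x, |d x| ≤ 1 := abs_rpow_succ_sub_le_one hr0 hr1
  have hstep : ∀ j ∈ Finset.range N, |rhoH H ((i : ℤ) - j)| ≤
      (d ((i : ℝ) - (j + 1 : ℕ)) - d ((i : ℝ) - j)) / 2 + if i = j then 2 else 0 := by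
    intro j _
    have e : rhoH H ((i : ℤ) - j) = -((d ((i : ℝ) - (j + 1 : ℕ)) - d ((i : ℝ) - j)) / 2) := by
      simp only [rhoH, d]
      push_cast
      rw [show (i : ℝ) - (j + 1) + 1 = i - j by ring, show (i : ℝ) - (j + 1) = i - j - 1 by ring]
      ring
    rw [e, abs_neg]
    split_ifs with hij
    · have h1 := abs_le.1 (hd ((i : ℝ) - (j + 1 : ℕ)))
      have h2 := abs_le.1 (hd ((i : ℝ) - j))
      rw [abs_le]
      constructor <;> linarith
    · have hx : 1 ≤ |(i : ℝ) - j| := by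
        have : 1 ≤ |(i : ℤ) - j| := Int.one_le_abs (sub_ne_zero.2 (by exact_mod_cast hij))
        exact_mod_cast this
      have hc := abs_rpow_succ_add_pred_le hr0 hr1 hx
      rw [abs_of_nonneg, add_zero]
      simp only [d]
      push_cast
      rw [show (i : ℝ) - (j + 1) + 1 = i - j by ring, show (i : ℝ) - (j + 1) = i - j - 1 by ring]
      linarith
  refine (Finset.sum_le_sum hstep).trans ?_
  rw [Finset.sum_add_distrib, ← Finset.sum_div,
    Finset.sum_range_sub fun j : ℕ => d ((i : ℝ) - j), Finset.sum_ite_eq]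
  have h1 := abs_le.1 (hd ((i : ℝ) - N))
  have h2 := abs_le.1 (hd ((i : ℝ) - (0 : ℕ)))
  generalize d ((i : ℝ) - N) = u at *
  generalize d ((i : ℝ) - (0 : ℕ)) = w at *
  split_ifs <;> linarith

/-- For unit mesh, the covariance between the midpoint of the process on `[p, p + 1]` and its
increment on `[j, j + 1]`, when increments have variance `|t - s| ^ r`. -/
def midIncrCov (r : ℝ) (p j : ℕ) : ℝ :=
  (|(j : ℝ) + 1| ^ r - |(j : ℝ)| ^ r) / 2 +
    (|(p : ℝ) - j + 1| ^ r - |(p : ℝ) - j - 1| ^ r) / 4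

theorem abs_midIncrCov_le_one (hr0 : 0 < r) (hr1 : r ≤ 1) (p j : ℕ) : |midIncrCov r p j| ≤ 1 := by
  have h1 := abs_le.1 (abs_rpow_succ_sub_le_one hr0 hr1 j)
  have h2 := abs_le.1 (abs_rpow_succ_sub_le_one hr0 hr1 ((p : ℝ) - j))
  have h3 := abs_le.1 (abs_rpow_succ_sub_le_one hr0 hr1 ((p : ℝ) - j - 1))
  rw [sub_add_cancel] at h3
  rw [midIncrCov, abs_le]
  constructor <;> linarith

theorem sum_abs_midIncrCov_le (hr0 : 0 < r) {p N : ℕ} (hp : p < N) :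
    ∑ j ∈ Finset.range N, |midIncrCov r p j| ≤ 3 / 2 * (N : ℝ) ^ r := by
  have hstep : ∀ j ∈ Finset.range N, |midIncrCov r p j| ≤
      |(|(j : ℝ) + 1| ^ r - |(j : ℝ)| ^ r)| / 2 +
      (|(|((p + 1 : ℕ) : ℝ) - j| ^ r - |((p + 1 : ℕ) : ℝ) - (j + 1 : ℕ)| ^ r)| / 4 +
        |(|(p : ℝ) - j| ^ r - |(p : ℝ) - (j + 1 : ℕ)| ^ r)| / 4) := by
    intro j _
    push_cast
    rw [show (p : ℝ) + 1 - j = p - j + 1 by ring, show (p : ℝ) + 1 - (j + 1) = p - j by ring,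
      show (p : ℝ) - (j + 1) = p - j - 1 by ring, midIncrCov]
    have a1 := abs_le.1 (le_refl |(|(j : ℝ) + 1| ^ r - |(j : ℝ)| ^ r)|)
    have a2 := abs_le.1 (le_refl |(|(p : ℝ) - j + 1| ^ r - |(p : ℝ) - j| ^ r)|)
    have a3 := abs_le.1 (le_refl |(|(p : ℝ) - j| ^ r - |(p : ℝ) - j - 1| ^ r)|)
    refine abs_le.2 ⟨?_, ?_⟩ <;> linarith
  refine (Finset.sum_le_sum hstep).trans ?_
  rw [Finset.sum_add_distrib, Finset.sum_add_distrib, ← Finset.sum_div, ← Finset.sum_div,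
    ← Finset.sum_div, sum_rpow_succ_sub hr0]
  have h1 := sum_abs_rpow_sub_le hr0 (p := p) (N := N) hp.le
  have h2 := sum_abs_rpow_sub_le hr0 (p := p + 1) (N := N) hp
  linarith

theorem sum_abs_midIncrCov_self_le (hr0 : 0 < r) (N : ℕ) :
    ∑ j ∈ Finset.range N, |midIncrCov r j j| ≤ 3 / 2 * (N : ℝ) ^ r := by
  have hstep : ∀ j ∈ Finset.range N, |midIncrCov r j j| =
      |(|(j : ℝ) + 1| ^ r - |(j : ℝ)| ^ r)| / 2 := by
    intro j _
    simp [midIncrCov, abs_div]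
  rw [Finset.sum_congr rfl hstep, ← Finset.sum_div, sum_rpow_succ_sub hr0]
  have : 0 ≤ (N : ℝ) ^ r := by positivity
  linarith

/-- The bound on the sum over `i3, i4` of all covariance products arising from two integrations
by parts. -/
theorem sum_sum_rhoH_add_midIncrCov_le {H : ℝ} (hr0 : 0 < 2 * H) (hr1 : 2 * H ≤ 1) {N i1 i2 : ℕ}
    (h1 : i1 < N) (h2 : i2 < N) {τ : ℝ} (hτ : 0 ≤ τ) :
    ∑ i3 ∈ Finset.range N, ∑ i4 ∈ Finset.range N,
      (|τ * rhoH H ((i3 : ℤ) - i4)| + ∑ a : Fin 4, ∑ b : Fin 4,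
        |τ * midIncrCov (2 * H) (![i1, i2, i3, i4] a) i3| *
          |τ * midIncrCov (2 * H) (![i1, i2, i3, i4] b) i4|) ≤
      N * τ * (3 + 24 * (τ * (N : ℝ) ^ (2 * H))) := by
  have hA : ∀ i4 ∈ Finset.range N, ∀ a : Fin 4, ∑ i3 ∈ Finset.range N,
      |midIncrCov (2 * H) (![i1, i2, i3, i4] a) i3| ≤ 3 / 2 * (N : ℝ) ^ (2 * H) := by
    intro i4 h4 a
    fin_cases a
    · exact sum_abs_midIncrCov_le hr0 h1
    · exact sum_abs_midIncrCov_le hr0 h2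
    · exact sum_abs_midIncrCov_self_le hr0 N
    · exact sum_abs_midIncrCov_le hr0 (Finset.mem_range.1 h4)
  have hρ : ∑ i3 ∈ Finset.range N, ∑ i4 ∈ Finset.range N, |τ * rhoH H ((i3 : ℤ) - i4)| ≤
      N * (τ * 3) := by
    rw [← nsmul_eq_mul]
    conv_rhs => rw [← Finset.card_range N]
    refine Finset.sum_le_card_nsmul _ _ _ fun i _ => ?_
    simp only [abs_mul, abs_of_nonneg hτ]
    rw [← Finset.mul_sum]
    exact mul_le_mul_of_nonneg_left (sum_abs_rhoH_le hr0 hr1 i N) hτ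
  have hm : ∑ i4 ∈ Finset.range N, ∑ i3 ∈ Finset.range N, ∑ a : Fin 4, ∑ b : Fin 4,
        |τ * midIncrCov (2 * H) (![i1, i2, i3, i4] a) i3| *
          |τ * midIncrCov (2 * H) (![i1, i2, i3, i4] b) i4| ≤
      N * (24 * τ * (τ * (N : ℝ) ^ (2 * H))) := by
    rw [← nsmul_eq_mul]
    conv_rhs => rw [← Finset.card_range N]
    refine Finset.sum_le_card_nsmul _ _ _ fun i4 h4 => ?_
    calc ∑ i3 ∈ Finset.range N, ∑ a : Fin 4, ∑ b : Fin 4,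
          |τ * midIncrCov (2 * H) (![i1, i2, i3, i4] a) i3| *
            |τ * midIncrCov (2 * H) (![i1, i2, i3, i4] b) i4|
        ≤ ∑ i3 ∈ Finset.range N, ∑ a : Fin 4, ∑ b : Fin 4,
          (τ * |midIncrCov (2 * H) (![i1, i2, i3, i4] a) i3|) * (τ * 1) := by
          gcongr with i3 _ a _ b _
          · rw [abs_mul, abs_of_nonneg hτ]
          · rw [abs_mul, abs_of_nonneg hτ]
            gcongr
            exact abs_midIncrCov_le_one hr0 hr1 _ _
      _ = 4 * τ ^ 2 * ∑ a : Fin 4, ∑ i3 ∈ Finset.range N,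
          |midIncrCov (2 * H) (![i1, i2, i3, i4] a) i3| := by
          rw [Finset.sum_comm, Finset.mul_sum]
          refine Finset.sum_congr rfl fun a _ => ?_
          rw [Finset.mul_sum]
          refine Finset.sum_congr rfl fun i3 _ => ?_
          simp
          ring
      _ ≤ 4 * τ ^ 2 * ∑ a : Fin 4, 3 / 2 * (N : ℝ) ^ (2 * H) := by
          gcongr with a _
          exact hA i4 h4 a
      _ = _ := by
          simp
          ring
  rw [Finset.sum_comm] at hm
  simp only [Finset.sum_add_distrib]
  linarith

end PowerSums

namespace IsCenteredGaussianProcess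

variable [MeasurableSpace Ω] {P : Measure Ω} {X : ℝ → Ω → ℝ} {C : ℝ → ℝ → ℝ} {H : ℝ}

theorem hasGaussianLaw (hX : IsCenteredGaussianProcess P X C) {κ : Type*} [Fintype κ]
    (ts : κ → ℝ) : HasGaussianLaw (fun ω k => X (ts k) ω) P := by
  classical
  let e := (Fintype.equivFin κ).symm
  refine ⟨isGaussian_of_map_eq_gaussianReal fun L => ?_⟩
  let w : κ → ℝ := fun k => L fun j => if k = j then 1 else 0
  refine ⟨0, _, Eq.trans ?_ (hX.2 _ (fun i => ts (e i)) fun i => w (e i))⟩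
  rw [Measure.map_map L.continuous.measurable (measurable_pi_lambda _ fun k => hX.1 _)]
  congr 1
  ext ω
  rw [e.sum_comp (fun k => w k * X (ts k) ω), Function.comp_apply]
  refine (L.toLinearMap.pi_apply_eq_sum_univ _).trans (Finset.sum_congr rfl fun k _ => ?_)
  exact mul_comm _ _

theorem hasLaw_apply (hX : IsCenteredGaussianProcess P X C) (s : ℝ) :
    HasLaw (X s) (gaussianReal 0 (C s s).toNNReal) P := by
  refine ⟨(hX.1 s).aemeasurable, ?_⟩
  simpa using hX.2 1 (fun _ => s) (fun _ => 1)

theorem hasLaw_sub (hX : IsCenteredGaussianProcess P X C) (s t : ℝ) :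
    HasLaw (fun ω => X s ω - X t ω)
      (gaussianReal 0 (C s s - C s t - C t s + C t t).toNNReal) P := by
  refine ⟨((hX.1 s).sub (hX.1 t)).aemeasurable, ?_⟩
  have h := hX.2 2 ![s, t] ![1, -1]
  simp only [Fin.sum_univ_two, Matrix.cons_val_zero, Matrix.cons_val_one] at h
  convert h using 2
  · ext ω
    ring
  · congr 1
    ring

theorem memLp_two (hX : IsCenteredGaussianProcess P X C) (s : ℝ) : MemLp (X s) 2 P :=
  (hX.hasLaw_apply s).hasGaussianLaw.memLp_two

theorem hasLaw_sub_covH (hX : IsCenteredGaussianProcess P X (covH H)) (hH : 0 < H) (s t : ℝ) :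
    HasLaw (fun ω => X s ω - X t ω) (gaussianReal 0 (|s - t| ^ (2 * H)).toNNReal) P := by
  convert hX.hasLaw_sub s t using 3
  simp only [covH, sub_self, abs_zero, Real.zero_rpow (by positivity : 2 * H ≠ 0), abs_sub_comm t s]
  ring

theorem covariance_covH (hX : IsCenteredGaussianProcess P X (covH H)) (hH : 0 < H) (s t : ℝ) :
    cov[X s, X t; P] = covH H s t := by
  have hP := (hX.hasLaw_apply s).isProbabilityMeasure
  have hvar : ∀ s, Var[X s; P] = |s| ^ (2 * H) := by
    intro s
    rw [(hX.hasLaw_apply s).variance_eq, variance_id_gaussianReal]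
    simp only [covH, sub_self, abs_zero, Real.zero_rpow (by positivity : 2 * H ≠ 0)]
    rw [sub_zero, add_self_div_two, Real.coe_toNNReal _ (by positivity)]
  have h := variance_fun_sub (hX.memLp_two s) (hX.memLp_two t)
  rw [(hX.hasLaw_sub_covH hH s t).variance_eq, variance_id_gaussianReal, hvar, hvar,
    Real.coe_toNNReal (|s - t| ^ (2 * H)) (by positivity)] at h
  rw [covH]
  linarith

theorem hasLaw_Xincr (hX : IsCenteredGaussianProcess P X (covH H)) (hH : 0 < H) (n j : ℕ) :
    HasLaw (Xincr X n j)
      (gaussianReal 0 (((2 : ℝ) ^ (-(n : ℝ) / 2)) ^ (2 * H)).toNNReal) P := by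
  convert hX.hasLaw_sub_covH hH (dyadicPt n (j + 1)) (dyadicPt n j) using 4
  · rfl
  rw [dyadicPt, dyadicPt, ← sub_mul, Nat.cast_add_one, add_sub_cancel_left, one_mul,
    abs_of_pos (by positivity)]

theorem covH_dyadicPt (H : ℝ) (n i j : ℕ) :
    covH H (dyadicPt n i) (dyadicPt n j) = ((2 : ℝ) ^ (-(n : ℝ) / 2)) ^ (2 * H) *
      ((|(i : ℝ)| ^ (2 * H) + |(j : ℝ)| ^ (2 * H) - |(i : ℝ) - j| ^ (2 * H)) / 2) := by
  have h0 : (0 : ℝ) ≤ (2 : ℝ) ^ (-(n : ℝ) / 2) := by positivity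
  simp only [covH, dyadicPt, ← sub_mul, abs_mul, abs_of_nonneg h0,
    Real.mul_rpow (abs_nonneg _) h0]
  ring

theorem covariance_Xincr (hX : IsCenteredGaussianProcess P X (covH H)) (hH : 0 < H) (n i j : ℕ) :
    cov[Xincr X n i, Xincr X n j; P] =
      ((2 : ℝ) ^ (-(n : ℝ) / 2)) ^ (2 * H) * rhoH H ((i : ℤ) - j) := by
  have hP := (hX.hasLaw_apply 0).hasGaussianLaw.isProbabilityMeasure
  unfold Xincr
  rw [covariance_fun_sub_left (hX.memLp_two _) (hX.memLp_two _)
      (Z := fun ω => X _ ω - X _ ω) ((hX.memLp_two _).sub (hX.memLp_two _)),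
    covariance_fun_sub_right (hX.memLp_two _) (hX.memLp_two _) (hX.memLp_two _),
    covariance_fun_sub_right (hX.memLp_two _) (hX.memLp_two _) (hX.memLp_two _)]
  simp only [hX.covariance_covH hH, covH_dyadicPt, rhoH]
  push_cast
  rw [show (i : ℝ) + 1 - (j + 1) = i - j by ring, show (i : ℝ) + 1 - j = i - j + 1 by ring,
    show (i : ℝ) - (j + 1) = i - j - 1 by ring]
  ring

theorem covariance_Xincr_midpoint (hX : IsCenteredGaussianProcess P X (covH H)) (hH : 0 < H)
    (n j p : ℕ) :
    cov[Xincr X n j, fun ω => (X (dyadicPt n (p + 1)) ω + X (dyadicPt n p) ω) / 2; P] =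
      ((2 : ℝ) ^ (-(n : ℝ) / 2)) ^ (2 * H) * midIncrCov (2 * H) p j := by
  have hP := (hX.hasLaw_apply 0).hasGaussianLaw.isProbabilityMeasure
  have hadd : ∀ u s t, cov[X u, fun ω => X s ω + X t ω; P] = cov[X u, X s; P] + cov[X u, X t; P] :=
    fun u s t => covariance_add_right (hX.memLp_two u) (hX.memLp_two s) (hX.memLp_two t)
  unfold Xincr
  rw [covariance_fun_div_right,
    covariance_fun_sub_left (hX.memLp_two _) (hX.memLp_two _)
      (Z := fun ω => X _ ω + X _ ω) ((hX.memLp_two _).add (hX.memLp_two _)), hadd, hadd]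
  simp only [hX.covariance_covH hH, covH_dyadicPt, midIncrCov]
  push_cast
  rw [abs_sub_comm ((j : ℝ) + 1) (p + 1), abs_sub_comm ((j : ℝ) + 1) p,
    abs_sub_comm (j : ℝ) (p + 1), abs_sub_comm (j : ℝ) p,
    show (p : ℝ) + 1 - (j + 1) = p - j by ring, show (p : ℝ) - (j + 1) = p - j - 1 by ring,
    show (p : ℝ) + 1 - j = p - j + 1 by ring]
  ring

end IsCenteredGaussianProcess

theorem integral_pow_four_of_hasLaw [MeasurableSpace Ω] {P : Measure Ω} {D : Ω → ℝ} {σ : ℝ}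
    (hσ : 0 ≤ σ) (hD : HasLaw D (gaussianReal 0 σ.toNNReal) P) :
    ∫ ω, D ω ^ 4 ∂P = σ ^ 2 * ∫ x, x ^ 4 ∂gaussianReal 0 1 := by
  have h : gaussianReal 0 σ.toNNReal = (gaussianReal 0 1).map (√σ * ·) := by
    rw [gaussianReal_map_const_mul, mul_zero, mul_one]
    congr 1
    ext
    simp [hσ, Real.sq_sqrt]
  have h1 := hD.integral_comp (f := fun x : ℝ => x ^ 4) (by fun_prop)
  rw [Function.comp_def] at h1
  rw [h1, h, integral_map (by fun_prop) (by fun_prop), ← integral_const_mul]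
  congr 1
  ext x
  rw [mul_pow, show (4 : ℕ) = 2 * 2 from rfl, pow_mul, Real.sq_sqrt hσ]

theorem CbSmooth.exists_abs_le {E : Type*} [NormedAddCommGroup E] [NormedSpace ℝ E] {g : E → ℝ}
    (hg : CbSmooth g) : ∃ M : ℝ, ∀ x, |g x| ≤ M := by
  obtain ⟨M, hM⟩ := hg.2 0
  exact ⟨M, fun x => by simpa using hM x⟩

theorem CbSmooth.fderiv_apply {E : Type*} [NormedAddCommGroup E] [NormedSpace ℝ E] {g : E → ℝ}
    (hg : CbSmooth g) (v : E) : CbSmooth fun x => fderiv ℝ g x v := by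
  have hd : ∀ n : ℕ, ContDiff ℝ n (fderiv ℝ g) := fun n =>
    (hg.1 (n + 1)).fderiv_right (by push_cast; rfl)
  refine ⟨fun n => (hd n).clm_apply contDiff_const, fun k => ?_⟩
  obtain ⟨M, hM⟩ := hg.2 (k + 1)
  refine ⟨‖ContinuousLinearMap.apply ℝ ℝ v‖ * M, fun x => ?_⟩
  refine ((ContinuousLinearMap.apply ℝ ℝ v).norm_iteratedFDeriv_comp_left
    (hd k).contDiffAt le_rfl).trans ?_
  rw [norm_iteratedFDeriv_fderiv]
  exact mul_le_mul_of_nonneg_left (hM x) (norm_nonneg _)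

theorem CbSmooth2.exists_hasDerivAt {f : ℝ → ℝ → ℝ} (hf : CbSmooth2 f) :
    ∃ f' : ℝ → ℝ → ℝ, CbSmooth2 f' ∧ ∀ x y, HasDerivAt (fun u => f u y) (f' x y) x := by
  refine ⟨fun x y => fderiv ℝ (fun p : ℝ × ℝ => f p.1 p.2) (x, y) (1, 0),
    CbSmooth.fderiv_apply hf (1, 0), fun x y => ?_⟩
  have h1 : HasFDerivAt (fun p : ℝ × ℝ => f p.1 p.2) _ (x, y) :=
    (((hf.1 1).differentiable (by simp)) (x, y)).hasFDerivAt
  exact h1.comp_hasDerivAt x ((hasDerivAt_id x).prodMk (hasDerivAt_const x y))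

theorem CbSmooth2.measurable {f : ℝ → ℝ → ℝ} (hf : CbSmooth2 f) :
    Measurable fun p : ℝ × ℝ => f p.1 p.2 :=
  (hf.1 0).continuous.measurable

theorem ProbabilityTheory.IndepFun.abs_integral_comp_le {α β : Type*} [MeasurableSpace Ω]
    [MeasurableSpace α] [MeasurableSpace β] {P : Measure Ω} [IsProbabilityMeasure P]
    {Z : Ω → α} {Y : Ω → β} (hZY : IndepFun Z Y P) (hZ : Measurable Z) (hY : Measurable Y)
    {G : α × β → ℝ} (hG : Measurable G) (hGi : Integrable (fun ω => G (Z ω, Y ω)) P)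
    {q : β → ℝ} (hq : Measurable q) (hqi : Integrable (fun ω => q (Y ω)) P)
    (hb : ∀ y, |∫ ω, G (Z ω, y) ∂P| ≤ q y) :
    |∫ ω, G (Z ω, Y ω) ∂P| ≤ ∫ ω, q (Y ω) ∂P := by
  have hmap := (indepFun_iff_map_prod_eq_prod_map_map hZ.aemeasurable hY.aemeasurable).1 hZY
  have := Measure.isProbabilityMeasure_map (μ := P) hZ.aemeasurable
  have := Measure.isProbabilityMeasure_map (μ := P) hY.aemeasurable
  have hZYm : Measurable fun ω => (Z ω, Y ω) := hZ.prodMk hY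
  have hi : Integrable G ((P.map Z).prod (P.map Y)) := by
    rw [← hmap, integrable_map_measure hG.aestronglyMeasurable hZYm.aemeasurable]
    exact hGi
  have h1 : ∫ ω, G (Z ω, Y ω) ∂P = ∫ y, ∫ z, G (z, y) ∂(P.map Z) ∂(P.map Y) := by
    rw [← integral_map hZYm.aemeasurable hG.aestronglyMeasurable, hmap, integral_prod_symm _ hi]
  have h2 : ∀ y, ∫ z, G (z, y) ∂(P.map Z) = ∫ ω, G (Z ω, y) ∂P := fun y =>
    integral_map hZ.aemeasurable (hG.comp measurable_prodMk_right).aestronglyMeasurable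
  rw [h1, ← integral_map hY.aemeasurable hq.aestronglyMeasurable]
  refine norm_integral_le_of_norm_le (f := fun y => ∫ z, G (z, y) ∂(P.map Z)) ?_
    (ae_of_all _ fun y => ?_)
  · rwa [integrable_map_measure hq.aestronglyMeasurable hY.aemeasurable]
  · rw [h2]
    exact hb y

theorem comap_pi_le_iSup_comap (X : ℝ → Ω → ℝ) {κ : Type*} (s : κ → ℝ) :
    MeasurableSpace.comap (fun ω k => X (s k) ω) MeasurableSpace.pi ≤
      ⨆ t : ℝ, MeasurableSpace.comap (X t) inferInstance := by
  simp_rw [MeasurableSpace.pi, MeasurableSpace.comap_iSup, MeasurableSpace.comap_comp]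
  exact iSup_le fun k => le_iSup (fun t => MeasurableSpace.comap (X t) inferInstance) (s k)

theorem IndepProcesses.indepFun [MeasurableSpace Ω] {P : Measure Ω} {X1 X2 : ℝ → Ω → ℝ}
    (h : IndepProcesses P X1 X2) {κ κ' : Type*} (s : κ → ℝ) (t : κ' → ℝ) :
    IndepFun (fun ω k => X1 (s k) ω) (fun ω k => X2 (t k) ω) P :=
  indep_of_indep_of_le_left (indep_of_indep_of_le_right h (comap_pi_le_iSup_comap X2 t))
    (comap_pi_le_iSup_comap X1 s)

/-- Two-step Gaussian integration by parts in the first process, the second process being frozen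
by independence. -/
theorem abs_integral_prod_Xmid_mul_le [MeasurableSpace Ω] {P : Measure Ω} [IsProbabilityMeasure P]
    {X1 X2 : ℝ → Ω → ℝ} {H : ℝ} (hH : 0 < H)
    (hX1 : IsCenteredGaussianProcess P X1 (covH H))
    (hX2 : IsCenteredGaussianProcess P X2 (covH H))
    (hInd : IndepProcesses P X1 X2) {ι : Type*} [Fintype ι] {f f' f'' : ι → ℝ → ℝ → ℝ} {M : ℝ}
    (hm : ∀ a, Measurable fun p : ℝ × ℝ => f a p.1 p.2)
    (hf : ∀ a x y, HasDerivAt (fun u => f a u y) (f' a x y) x)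
    (hf' : ∀ a x y, HasDerivAt (fun u => f' a u y) (f'' a x y) x)
    (hM : ∀ a x y, |f a x y| ≤ M) (hM' : ∀ a x y, |f' a x y| ≤ M)
    (hM'' : ∀ a x y, |f'' a x y| ≤ M) {c : ℝ} (hc : 0 ≤ c) {n j k : ℕ} {p : ι → ℕ} {τ : ℝ}
    (hτ : τ = ((2 : ℝ) ^ (-(n : ℝ) / 2)) ^ (2 * H)) :
    |∫ ω, (∏ a, Xmid X1 X2 (f a) n (p a) ω) * (Xincr X1 n j ω * (Xincr X2 n j ω ^ 2 - c)) *
        (Xincr X1 n k ω * (Xincr X2 n k ω ^ 2 - c)) ∂P| ≤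
      M ^ Fintype.card ι * (|τ * rhoH H ((j : ℤ) - k)| +
          ∑ a, ∑ b, |τ * midIncrCov (2 * H) (p a) j| * |τ * midIncrCov (2 * H) (p b) k|) *
        (2 * (τ ^ 2 * (∫ x, x ^ 4 ∂gaussianReal 0 1) + c ^ 2)) := by
  have hτ0 : 0 ≤ τ := hτ ▸ by positivity
  let idx : Option (Option ι) → ℕ := fun o => o.elim j fun o' => o'.elim k p
  let ts : Option (Option ι) × Bool → ℝ := fun r =>
    dyadicPt n (bif r.2 then idx r.1 + 1 else idx r.1)
  let incr : Option (Option ι) → (Option (Option ι) × Bool → ℝ) → ℝ := fun o z =>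
    z (o, true) - z (o, false)
  let mid : ι → (Option (Option ι) × Bool → ℝ) → ℝ := fun a z =>
    (z (some (some a), true) + z (some (some a), false)) / 2
  let Q : (Option (Option ι) × Bool → ℝ) → ℝ := fun y =>
    (incr none y ^ 2 - c) * (incr (some none) y ^ 2 - c)
  let S : (Option (Option ι) × Bool → ℝ) → ℝ := fun y =>
    (incr none y ^ 4 + c ^ 2) + (incr (some none) y ^ 4 + c ^ 2)
  let B := M ^ Fintype.card ι * (|τ * rhoH H ((j : ℤ) - k)| +
    ∑ a, ∑ b, |τ * midIncrCov (2 * H) (p a) j| * |τ * midIncrCov (2 * H) (p b) k|)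
  have hincr : ∀ o, Measurable (incr o) := fun o => by fun_prop
  have hmid : ∀ a, Measurable (mid a) := fun a => by fun_prop
  have hQm : Measurable Q := by fun_prop
  have hSm : Measurable S := by fun_prop
  have hQS : ∀ y, |Q y| ≤ S y := fun y => by
    refine abs_le.2 ⟨?_, ?_⟩ <;> nlinarith [mul_nonneg hc (sq_nonneg (incr none y)),
      mul_nonneg hc (sq_nonneg (incr (some none) y)),
      sq_nonneg (incr none y ^ 2 - c + (incr (some none) y ^ 2 - c)),
      sq_nonneg (incr none y ^ 2 - c - (incr (some none) y ^ 2 - c)),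
      sq_nonneg (incr none y ^ 2 - c), sq_nonneg (incr (some none) y ^ 2 - c)]
  let Z : Ω → Option (Option ι) × Bool → ℝ := fun ω r => X1 (ts r) ω
  let Y : Ω → Option (Option ι) × Bool → ℝ := fun ω r => X2 (ts r) ω
  have hZ : Measurable Z := measurable_pi_lambda _ fun _ => hX1.1 _
  have hY : Measurable Y := measurable_pi_lambda _ fun _ => hX2.1 _
  have hZY : IndepFun Z Y P := hInd.indepFun ts ts
  have hpow : ∀ i, Integrable (fun ω => Xincr X2 n i ω ^ 4) P := fun i => by
    have h4 := (hX2.hasLaw_Xincr hH n i).hasGaussianLaw.memLp (p := 4) (by simp)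
    simpa [Even.pow_abs (show Even 4 by decide)] using h4.integrable_norm_pow (by simp)
  have hpow' : ∀ i, Integrable (fun ω => Xincr X2 n i ω ^ 4 + c ^ 2) P := fun i =>
    (hpow i).add (integrable_const _)
  have hSi : Integrable (fun ω => S (Y ω)) P := (hpow' j).add (hpow' k)
  have hQi : Integrable (fun ω => Q (Y ω)) P :=
    hSi.mono' (hQm.comp hY).aestronglyMeasurable (ae_of_all _ fun ω => hQS _)
  have hDE : Integrable (fun ω => incr none (Z ω) * incr (some none) (Z ω)) P :=
    (hX1.hasLaw_Xincr hH n j).hasGaussianLaw.memLp_two.integrable_mul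
      (hX1.hasLaw_Xincr hH n k).hasGaussianLaw.memLp_two
  let G : (Option (Option ι) × Bool → ℝ) × (Option (Option ι) × Bool → ℝ) → ℝ := fun w =>
    (incr none w.1 * incr (some none) w.1) * Q w.2 * ∏ a, f a (mid a w.1) (mid a w.2)
  have hprod : Measurable fun w : (Option (Option ι) × Bool → ℝ) ×
      (Option (Option ι) × Bool → ℝ) => ∏ a, f a (mid a w.1) (mid a w.2) :=
    Finset.measurable_fun_prod _ fun a _ =>
      (hm a).comp (((hmid a).comp measurable_fst).prodMk ((hmid a).comp measurable_snd))
  have hG : Measurable G :=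
    ((((hincr _).comp measurable_fst).mul ((hincr _).comp measurable_fst)).mul
      (hQm.comp measurable_snd)).mul hprod
  have hGi : Integrable (fun ω => G (Z ω, Y ω)) P := by
    have hind : IndepFun (fun ω => incr none (Z ω) * incr (some none) (Z ω)) (fun ω => Q (Y ω)) P :=
      hZY.comp ((hincr none).mul (hincr (some none))) hQm
    exact (hind.integrable_mul hDE hQi).mul_bdd (c := M ^ Fintype.card ι)
      (hprod.comp (hZ.prodMk hY)).aestronglyMeasurable
      (ae_of_all _ fun ω => abs_prod_le_pow_card fun a => hM a _ _)
  have hmean : ∀ i, ∫ ω, Xincr X1 n i ω ∂P = 0 := fun i => by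
    rw [(hX1.hasLaw_Xincr hH n i).integral_eq, integral_id_gaussianReal]
  have hlaw : HasGaussianLaw (fun ω => (Xincr X1 n j ω, fun o : Option ι =>
      o.elim (Xincr X1 n k ω) fun a => mid a (Z ω))) P := by
    let e : Option (Option ι) × Bool → (Option (Option ι) × Bool → ℝ) →L[ℝ] ℝ := fun r =>
      ContinuousLinearMap.proj r
    let L : Option (Option ι) → (Option (Option ι) × Bool → ℝ) →L[ℝ] ℝ := fun o =>
      e (o, true) - e (o, false)
    let L' : ι → (Option (Option ι) × Bool → ℝ) →L[ℝ] ℝ := fun a =>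
      (2 : ℝ)⁻¹ • (e (some (some a), true) + e (some (some a), false))
    refine ((hX1.hasGaussianLaw ts).map_fun ((L none).prod (ContinuousLinearMap.pi
      fun o : Option ι => o.elim (L (some none)) L'))).congr (ae_of_all _ fun ω => ?_)
    refine Prod.ext rfl (funext fun o => ?_)
    cases o with
    | none => rfl
    | some a => exact (div_eq_inv_mul _ _).symm
  have hcov := fun y => hlaw.abs_integral_mul_mul_prod_le (hmean j) (hmean k)
    (h := fun a x => f a x (mid a y)) (h' := fun a x => f' a x (mid a y))
    (h'' := fun a x => f'' a x (mid a y)) (M := M) (fun a x => hf a x _) (fun a x => hf' a x _)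
    (fun a x => hM a x _) (fun a x => hM' a x _) (fun a x => hM'' a x _)
  have hcm : ∀ i a, cov[Xincr X1 n i, fun ω => mid a (Z ω); P] =
      τ * midIncrCov (2 * H) (p a) i := fun i a =>
    hτ ▸ hX1.covariance_Xincr_midpoint hH n i (p a)
  simp only [hcm, hX1.covariance_Xincr hH, ← hτ] at hcov
  have hb : ∀ y, |∫ ω, G (Z ω, y) ∂P| ≤ B * S y := by
    intro y
    have : ∀ ω, G (Z ω, y) = (Xincr X1 n j ω * (Xincr X1 n k ω *
        ∏ a, f a (mid a (Z ω)) (mid a y))) * Q y := fun ω => by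
      change Xincr X1 n j ω * Xincr X1 n k ω * Q y * _ = _
      ring
    simp_rw [this]
    rw [integral_mul_const, abs_mul]
    exact mul_le_mul (hcov y) (hQS y) (abs_nonneg _) ((abs_nonneg _).trans (hcov y))
  have hmain := hZY.abs_integral_comp_le hZ hY hG hGi (hSm.const_mul B) (hSi.const_mul B) hb
  have hS : ∫ ω, S (Y ω) ∂P = 2 * (τ ^ 2 * (∫ x, x ^ 4 ∂gaussianReal 0 1) + c ^ 2) := by
    have h4 : ∀ i, ∫ ω, Xincr X2 n i ω ^ 4 + c ^ 2 ∂P =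
        τ ^ 2 * (∫ x, x ^ 4 ∂gaussianReal 0 1) + c ^ 2 := fun i => by
      rw [integral_add (hpow i) (integrable_const _),
        integral_pow_four_of_hasLaw hτ0 (hτ ▸ hX2.hasLaw_Xincr hH n i)]
      simp
    change ∫ ω, (Xincr X2 n j ω ^ 4 + c ^ 2) + (Xincr X2 n k ω ^ 4 + c ^ 2) ∂P = _
    rw [integral_add (hpow' j) (hpow' k), h4, h4]
    ring
  rw [integral_const_mul, hS] at hmain
  refine le_trans (le_of_eq ?_) hmain
  congr 2
  ext ω
  change (∏ a, f a (mid a (Z ω)) (mid a (Y ω))) * (Xincr X1 n j ω * (Xincr X2 n j ω ^ 2 - c)) *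
    (Xincr X1 n k ω * (Xincr X2 n k ω ^ 2 - c)) = Xincr X1 n j ω * Xincr X1 n k ω *
      ((Xincr X2 n j ω ^ 2 - c) * (Xincr X2 n k ω ^ 2 - c)) * _
  ring

theorem CbSmooth2.exists_two_derivatives {ι : Type*} [Fintype ι] {f : ι → ℝ → ℝ → ℝ}
    (hf : ∀ a, CbSmooth2 (f a)) :
    ∃ (f' f'' : ι → ℝ → ℝ → ℝ) (M : ℝ),
      (∀ a x y, HasDerivAt (fun u => f a u y) (f' a x y) x) ∧
      (∀ a x y, HasDerivAt (fun u => f' a u y) (f'' a x y) x) ∧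
      (∀ a x y, |f a x y| ≤ M) ∧ (∀ a x y, |f' a x y| ≤ M) ∧ ∀ a x y, |f'' a x y| ≤ M := by
  choose f' hf' hd using fun a => (hf a).exists_hasDerivAt
  choose f'' hf'' hd' using fun a => (hf' a).exists_hasDerivAt
  have hbdd : ∀ {g : ι → ℝ → ℝ → ℝ}, (∀ a, CbSmooth2 (g a)) → ∃ M, ∀ a x y, |g a x y| ≤ M := by
    intro g hg
    choose M hM using fun a => CbSmooth.exists_abs_le (hg a)
    obtain ⟨K, hK⟩ := (Set.finite_range M).bddAbove
    exact ⟨K, fun a x y => (hM a (x, y)).trans (hK ⟨a, rfl⟩)⟩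
  obtain ⟨M, hM⟩ := hbdd hf
  obtain ⟨M', hM'⟩ := hbdd hf'
  obtain ⟨M'', hM''⟩ := hbdd hf''
  exact ⟨f', f'', max M (max M' M''), hd, hd', fun a x y => (hM a x y).trans (by simp),
    fun a x y => (hM' a x y).trans (by simp), fun a x y => (hM'' a x y).trans (by simp)⟩

theorem nSteps_mul_le {n : ℕ} {t : ℝ} (ht : 0 ≤ t) :
    (nSteps n t : ℝ) * (2 : ℝ) ^ (-(n : ℝ) / 2) ≤ t := by
  have h := Nat.floor_le (mul_nonneg (by positivity : (0 : ℝ) ≤ (2 : ℝ) ^ ((n : ℝ) / 2)) ht)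
  calc (nSteps n t : ℝ) * (2 : ℝ) ^ (-(n : ℝ) / 2)
      ≤ ((2 : ℝ) ^ ((n : ℝ) / 2) * t) * (2 : ℝ) ^ (-(n : ℝ) / 2) :=
        mul_le_mul_of_nonneg_right h (by positivity)
    _ = t := by
        rw [mul_right_comm, ← Real.rpow_add two_pos, neg_div, add_neg_cancel, Real.rpow_zero,
          one_mul]

theorem rpow_le_one_add {t r : ℝ} (ht : 0 ≤ t) (hr0 : 0 ≤ r) (hr1 : r ≤ 1) : t ^ r ≤ 1 + t := by
  rcases le_total t 1 with h | h
  · exact (Real.rpow_le_one ht h hr0).trans (by linarith)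
  · have := Real.rpow_le_rpow_of_exponent_le h hr1
    rw [Real.rpow_one] at this
    linarith

theorem mixed_chaos_moment_bound_two_free_indices
    {Ω : Type*} [MeasurableSpace Ω] (P : Measure Ω) [IsProbabilityMeasure P]
    (X1 X2 : ℝ → Ω → ℝ)
    (hX1 : IsCenteredGaussianProcess P X1 (covH (1 / 6)))
    (hX2 : IsCenteredGaussianProcess P X2 (covH (1 / 6)))
    (hInd : IndepProcesses P X1 X2)
    (f1 f2 f3 f4 : ℝ → ℝ → ℝ)
    (hf1 : CbSmooth2 f1) (hf2 : CbSmooth2 f2) (hf3 : CbSmooth2 f3) (hf4 : CbSmooth2 f4) :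
    ∃ C : ℝ, 0 < C ∧ ∀ t : ℝ, 0 ≤ t → ∀ n : ℕ, 1 ≤ n →
      ∀ i1 ∈ Finset.range (nSteps n t), ∀ i2 ∈ Finset.range (nSteps n t),
        (∑ i3 ∈ Finset.range (nSteps n t), ∑ i4 ∈ Finset.range (nSteps n t),
          abs (∫ ω,
            (Xmid X1 X2 f1 n i1 ω * Xmid X1 X2 f2 n i2 ω *
              Xmid X1 X2 f3 n i3 ω * Xmid X1 X2 f4 n i4 ω *
              (Xincr X1 n i3 ω * (Xincr X2 n i3 ω ^ 2 - (2 : ℝ) ^ (-(n : ℝ) / 3))) *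
              (Xincr X1 n i4 ω * (Xincr X2 n i4 ω ^ 2 - (2 : ℝ) ^ (-(n : ℝ) / 3)))) ∂P)) ≤
        C * (t + t ^ 2) := by
  have hf : ∀ a, CbSmooth2 (![f1, f2, f3, f4] a) := fun a => by
    fin_cases a
    exacts [hf1, hf2, hf3, hf4]
  obtain ⟨f', f'', M, hd, hd', hM, hM', hM''⟩ := CbSmooth2.exists_two_derivatives hf
  set K := ∫ x, x ^ 4 ∂gaussianReal 0 1
  have hK : 0 ≤ K := integral_nonneg fun x => by positivity
  have hA : 0 ≤ M ^ 4 * (2 * (K + 1)) := mul_nonneg (Even.pow_nonneg (by decide) _) (by positivity)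
  refine ⟨M ^ 4 * (2 * (K + 1)) * 27 + 1, by positivity, fun t ht n _ i1 hi1 i2 hi2 => ?_⟩
  set N := nSteps n t
  obtain ⟨τ, hτ⟩ : ∃ τ : ℝ, τ = ((2 : ℝ) ^ (-(n : ℝ) / 2)) ^ (2 * (1 / 6) : ℝ) := ⟨_, rfl⟩
  have hτ0 : 0 ≤ τ := hτ ▸ by positivity
  have hτ1 : τ ≤ 1 := by
    rw [hτ]
    refine Real.rpow_le_one (by positivity) ?_ (by norm_num)
    exact Real.rpow_le_one_of_one_le_of_nonpos one_le_two (by linarith [n.cast_nonneg (α := ℝ)])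
  have hτ2 : (2 : ℝ) ^ (-(n : ℝ) / 3) = τ ^ 2 := by
    rw [hτ, ← Real.rpow_mul two_pos.le, ← Real.rpow_mul_natCast two_pos.le]
    congr 1
    push_cast
    ring
  have hτ3 : τ ^ 3 = (2 : ℝ) ^ (-(n : ℝ) / 2) := by
    rw [hτ, ← Real.rpow_mul two_pos.le, ← Real.rpow_mul_natCast two_pos.le]
    congr 1
    push_cast
    ring
  have hN : N * τ ^ 3 ≤ t := hτ3 ▸ nSteps_mul_le ht
  have hNr : τ * (N : ℝ) ^ (2 * (1 / 6) : ℝ) ≤ 1 + t := by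
    rw [hτ, ← Real.mul_rpow (by positivity) (by positivity), mul_comm]
    exact (Real.rpow_le_rpow (by positivity) (nSteps_mul_le ht) (by norm_num)).trans
      (rpow_le_one_add ht (by norm_num) (by norm_num))
  have hterm := fun i3 i4 : ℕ => abs_integral_prod_Xmid_mul_le (by norm_num) hX1 hX2 hInd
    (fun a => (hf a).measurable) hd hd' hM hM' hM'' (sq_nonneg τ) (n := n) (j := i3) (k := i4)
    (p := ![i1, i2, i3, i4]) hτ
  have hfac : 2 * (τ ^ 2 * K + (τ ^ 2) ^ 2) ≤ 2 * (K + 1) * τ ^ 2 := by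
    nlinarith [mul_le_mul_of_nonneg_left (pow_le_one₀ hτ0 hτ1 : τ ^ 2 ≤ 1) (sq_nonneg τ)]
  have hsum := sum_sum_rhoH_add_midIncrCov_le (H := 1 / 6) (by norm_num) (by norm_num)
    (Finset.mem_range.1 hi1) (Finset.mem_range.1 hi2) hτ0
  calc _ ≤ ∑ i3 ∈ Finset.range N, ∑ i4 ∈ Finset.range N, M ^ 4 * (2 * (K + 1)) * τ ^ 2 *
        (|τ * rhoH (1 / 6) ((i3 : ℤ) - i4)| + ∑ a : Fin 4, ∑ b : Fin 4,
          |τ * midIncrCov (2 * (1 / 6)) (![i1, i2, i3, i4] a) i3| *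
            |τ * midIncrCov (2 * (1 / 6)) (![i1, i2, i3, i4] b) i4|) := by
        refine Finset.sum_le_sum fun i3 _ => Finset.sum_le_sum fun i4 _ => ?_
        rw [hτ2]
        have h := hterm i3 i4
        simp only [Fin.prod_univ_four, Fintype.card_fin] at h
        refine (h.trans (mul_le_mul_of_nonneg_left hfac ?_)).trans (le_of_eq (by ring))
        exact mul_nonneg (Even.pow_nonneg (by decide) _) (by positivity)
    _ = M ^ 4 * (2 * (K + 1)) * τ ^ 2 * ∑ i3 ∈ Finset.range N, ∑ i4 ∈ Finset.range N, _ := by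
        simp_rw [Finset.mul_sum]
    _ ≤ M ^ 4 * (2 * (K + 1)) * τ ^ 2 *
        (N * τ * (3 + 24 * (τ * (N : ℝ) ^ (2 * (1 / 6) : ℝ)))) :=
        mul_le_mul_of_nonneg_left hsum (mul_nonneg hA (sq_nonneg τ))
    _ = M ^ 4 * (2 * (K + 1)) *
        (N * τ ^ 3 * (3 + 24 * (τ * (N : ℝ) ^ (2 * (1 / 6) : ℝ)))) := by ring
    _ ≤ M ^ 4 * (2 * (K + 1)) * (t * (3 + 24 * (1 + t))) := by gcongr
    _ ≤ (M ^ 4 * (2 * (K + 1)) * 27 + 1) * (t + t ^ 2) := by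
        nlinarith [mul_nonneg hA (sq_nonneg t), sq_nonneg t]

end
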